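/- arXiv:2206.09294 — 4 statements merged into one kernel-verified Lean document; each statement's English description precedes it below -/
import Mathlib

section
/- For all f, g ∈ V, the symmetric cosine–sine sandwich of a field cosine contracts to a real multiple of itself: C(f)·C(g)·C(f) + S(f)·C(g)·S(f) = cos(E(f,g))·C(g), where cos(E(f,g)) ∈ ℝ acts by scalar multiplication. -/
theorem weyl_sandwich_cos
    {A : Type*} [Ring A] [Algebra ℂ A]
    {V : Type*} [AddCommGroup V] [Module ℝ V]
    (E : V →ₗ[ℝ] V →ₗ[ℝ] ℝ)
    (hE : ∀ f g : V, E f g = - E g f)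
    (W : V → A)
    (hW0 : W 0 = 1)
    (hW : ∀ f g : V, W f * W g
        = Complex.exp (-(Complex.I / 2) * (E f g : ℂ)) • W (f + g))
    (C S : V → A)
    (hC : ∀ f : V, C f = (2 : ℂ)⁻¹ • (W f + W (-f)))
    (hS : ∀ f : V, S f = (2 * Complex.I)⁻¹ • (W f - W (-f))) :
    ∀ f g : V,
      C f * C g * C f + S f * C g * S f
        = ((Real.cos (E f g) : ℝ) : ℂ) • C g := by
  intro f g
  have hff : ∀ f : V, E f f = 0 := fun f => by linarith [hE f f]
  have key : ∀ f g : V, W f * W g * W (-f)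
      = Complex.exp (-(E f g : ℂ) * Complex.I) • W g := by
    intro f g
    have h1 : E (f + g) (-f) = E f g := by
      simp only [map_add, map_neg, LinearMap.add_apply, hff]
      linarith [hE f g]
    rw [hW, smul_mul_assoc, hW, smul_smul, ← Complex.exp_add, h1]
    congr 1
    · congr 1; ring
    · congr 1; abel
  have k1 := key f g
  have k2 := key f (-g)
  have k3 := key (-f) g
  have k4 := key (-f) (-g)
  simp only [map_neg, LinearMap.neg_apply, neg_neg, Complex.ofReal_neg] at k1 k2 k3 k4
  have hI : (2 * Complex.I)⁻¹ * (2 * Complex.I)⁻¹ = -((2 : ℂ)⁻¹ * (2 : ℂ)⁻¹) := by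
    rw [mul_inv, mul_mul_mul_comm, ← mul_inv Complex.I, Complex.I_mul_I]
    norm_num
  have gen : ∀ a b X : A,
      ((2 : ℂ)⁻¹ • (a + b)) * X * ((2 : ℂ)⁻¹ • (a + b))
        + ((2 * Complex.I)⁻¹ • (a - b)) * X * ((2 * Complex.I)⁻¹ • (a - b))
      = (2 : ℂ)⁻¹ • (a * X * b + b * X * a) := by
    intro a b X
    simp only [smul_mul_assoc, mul_smul_comm, smul_smul, hI]
    simp only [add_mul, mul_add, sub_mul, mul_sub]
    module
  rw [hC f, hS f, gen, hC g]
  simp only [smul_mul_assoc, mul_smul_comm, mul_add, add_mul, k1, k2, k3, k4]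
  rw [Complex.ofReal_cos, Complex.cos]
  module
end

section
/- For all f, g ∈ V, the symmetric cosine–sine sandwich of a field sine contracts to a real multiple of itself: C(f)·S(g)·C(f) + S(f)·S(g)·S(f) = cos(E(f,g))·S(g), where cos(E(f,g)) ∈ ℝ acts by scalar multiplication. -/
theorem weyl_sandwich_sin
    {A : Type*} [Ring A] [Algebra ℂ A]
    {V : Type*} [AddCommGroup V] [Module ℝ V]
    (E : V →ₗ[ℝ] V →ₗ[ℝ] ℝ)
    (hE : ∀ f g : V, E f g = - E g f)
    (W : V → A)
    (hW0 : W 0 = 1)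
    (hW : ∀ f g : V, W f * W g
        = Complex.exp (-(Complex.I / 2) * (E f g : ℂ)) • W (f + g))
    (C S : V → A)
    (hC : ∀ f : V, C f = (2 : ℂ)⁻¹ • (W f + W (-f)))
    (hS : ∀ f : V, S f = (2 * Complex.I)⁻¹ • (W f - W (-f))) :
    ∀ f g : V,
      C f * S g * C f + S f * S g * S f
        = ((Real.cos (E f g) : ℝ) : ℂ) • S g := by
  have key : ∀ f g : V, W f * W g * W (-f) = Complex.exp (-(E f g : ℂ) * Complex.I) • W g := by
    intro f g
    have h0 : E f f = 0 := by linarith [hE f f]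
    have h1 : E (f + g) (-f) = E f g := by
      simp only [map_add, map_neg, LinearMap.add_apply, h0]
      linarith [hE f g]
    rw [hW, smul_mul_assoc, hW, smul_smul, ← Complex.exp_add, h1]
    congr 1
    · congr 1; ring
    · congr 1; abel
  intro f g
  have k1 := key f g
  have k2 := key f (-g)
  have k3 := key (-f) g
  have k4 := key (-f) (-g)
  simp only [map_neg, LinearMap.neg_apply, neg_neg, Complex.ofReal_neg] at k1 k2 k3 k4
  have hI : (2 * Complex.I)⁻¹ * (2 * Complex.I)⁻¹ = -(4 : ℂ)⁻¹ := by
    rw [← mul_inv, show (2 * Complex.I) * (2 * Complex.I) = 4 * (Complex.I * Complex.I) by ring,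
      Complex.I_mul_I]
    norm_num
  have h4 : (2 : ℂ)⁻¹ * (2 : ℂ)⁻¹ = (4 : ℂ)⁻¹ := by norm_num
  have hcos : ((Real.cos (E f g) : ℝ) : ℂ)
      = (2 : ℂ)⁻¹ * (Complex.exp ((E f g : ℂ) * Complex.I)
        + Complex.exp (-(E f g : ℂ) * Complex.I)) := by
    rw [Complex.ofReal_cos, Complex.cos]; ring
  have hX : W f * (W g - W (-g)) * W (-f) + W (-f) * (W g - W (-g)) * W f
      = (Complex.exp ((E f g : ℂ) * Complex.I)
        + Complex.exp (-(E f g : ℂ) * Complex.I)) • (W g - W (-g)) := by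
    simp only [mul_sub, sub_mul, k1, k2, k3, k4, add_smul, smul_sub]
    abel
  have hpol : ∀ a b x : A, (a + b) * x * (a + b) - (a - b) * x * (a - b)
      = (2 : ℂ) • (a * x * b + b * x * a) := by
    intro a b x
    rw [two_smul]
    noncomm_ring
  have gen : ∀ x : A, C f * x * C f + S f * x * S f
      = (2 : ℂ)⁻¹ • (W f * x * W (-f) + W (-f) * x * W f) := by
    intro x
    rw [hC, hS]
    simp only [smul_mul_assoc, mul_smul_comm, smul_smul]
    rw [hI, h4, neg_smul, ← sub_eq_add_neg, ← smul_sub, hpol, smul_smul]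
    norm_num
  rw [gen, hS g, hcos]
  simp only [smul_mul_assoc, mul_smul_comm]
  rw [← smul_add, hX]
  simp only [smul_smul]
  congr 1
  ring
end

section
/- For all f, g ∈ V, the antisymmetric sandwich of a field cosine produces a field sine: C(f)·C(g)·S(f) − S(f)·C(g)·C(f) = i·sin(E(f,g))·S(g), where i·sin(E(f,g)) ∈ ℂ acts by scalar multiplication. -/
theorem weyl_antisym_sandwich
    {A : Type*} [Ring A] [Algebra ℂ A]
    {V : Type*} [AddCommGroup V] [Module ℝ V]
    (E : V →ₗ[ℝ] V →ₗ[ℝ] ℝ)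
    (hE : ∀ f g : V, E f g = - E g f)
    (W : V → A)
    (hW0 : W 0 = 1)
    (hW : ∀ f g : V, W f * W g
        = Complex.exp (-(Complex.I / 2) * (E f g : ℂ)) • W (f + g))
    (C S : V → A)
    (hC : ∀ f : V, C f = (2 : ℂ)⁻¹ • (W f + W (-f)))
    (hS : ∀ f : V, S f = (2 * Complex.I)⁻¹ • (W f - W (-f))) :
    ∀ f g : V,
      C f * C g * S f - S f * C g * C f
        = (Complex.I * ((Real.sin (E f g) : ℝ) : ℂ)) • S g := by
  intro f g
  have hEff : ∀ x : V, E x x = 0 := fun x => by have := hE x x; linarith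
  have key : ∀ x h : V, W x * W h * W (-x)
      = Complex.exp (-(Complex.I * (E x h : ℂ))) • W h := by
    intro x h
    rw [hW, smul_mul_assoc, hW, smul_smul, ← Complex.exp_add]
    have h1 : x + h + -x = h := by abel
    have h2 : E (x + h) (-x) = E x h := by
      simp only [map_add, map_neg, LinearMap.add_apply, hEff x]
      rw [hE h x]; ring
    rw [h1, h2]
    congr 2
    ring
  have k1 := key f g
  have k2 := key f (-g)
  have k3 := key (-f) g
  have k4 := key (-f) (-g)
  simp only [map_neg, LinearMap.neg_apply, neg_neg, Complex.ofReal_neg, mul_neg] at k1 k2 k3 k4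
  have e : Complex.exp (Complex.I * (E f g : ℂ)) - Complex.exp (-(Complex.I * (E f g : ℂ)))
      = 2 * Complex.I * Complex.sin (E f g : ℂ) := by
    rw [Complex.sin, mul_comm Complex.I, ← neg_mul]
    linear_combination (-Complex.exp (-(E f g : ℂ) * Complex.I)
      + Complex.exp ((E f g : ℂ) * Complex.I)) * Complex.I_mul_I
  have expand : C f * C g * S f - S f * C g * C f
      = ((2 : ℂ)⁻¹ * (2 : ℂ)⁻¹ * (2 * Complex.I)⁻¹ * 2) •
        ((W (-f) * W g * W f + W (-f) * W (-g) * W f)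
          - (W f * W g * W (-f) + W f * W (-g) * W (-f))) := by
    rw [hC, hC, hS]
    simp only [smul_mul_assoc, mul_smul_comm, mul_add, add_mul, mul_sub, sub_mul]
    module
  rw [expand, k1, k2, k3, k4, hS, Complex.ofReal_sin]
  have e2 : Complex.exp (Complex.I * (E f g : ℂ))
      = Complex.exp (-(Complex.I * (E f g : ℂ))) + 2 * Complex.I * Complex.sin (E f g : ℂ) := by
    rw [← e]; ring
  rw [e2]
  match_scalars <;> field_simp <;> ring
end

section
/- For all f, g ∈ V, the quasifree expectation of the symmetric sandwich equals ω(C(f)·C(g)·C(f) + S(f)·C(g)·S(f)) = cos(E(f,g))·exp(−Q(g,g)/2); in particular, taking g replaced by 2g, ω(C(f)·C(2g)·C(f) + S(f)·C(2g)·S(f)) = cos(2·E(f,g))·exp(−2·Q(g,g)), which is the coefficient appearing in the delta-coupled detector channel. -/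
/-- Quasifree expectation of the symmetric cosine–sine sandwich:
`ω(C(f)C(g)C(f) + S(f)C(g)S(f)) = cos(E(f,g)) e^{-Q(g,g)/2}`, and with `g ↦ 2g`,
`ω(C(f)C(2g)C(f) + S(f)C(2g)S(f)) = cos(2E(f,g)) e^{-2Q(g,g)}`. -/
theorem quasifree_sandwich_expectation
    {A : Type*} [Ring A] [Algebra ℂ A]
    {V : Type*} [AddCommGroup V] [Module ℝ V]
    (E : V →ₗ[ℝ] V →ₗ[ℝ] ℝ)
    (hE : ∀ f g : V, E f g = - E g f)
    (W : V → A)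
    (hW0 : W 0 = 1)
    (hW : ∀ f g : V, W f * W g
        = Complex.exp (-(Complex.I / 2) * (E f g : ℂ)) • W (f + g))
    (C S : V → A)
    (hC : ∀ f : V, C f = (2 : ℂ)⁻¹ • (W f + W (-f)))
    (hS : ∀ f : V, S f = (2 * Complex.I)⁻¹ • (W f - W (-f)))
    (Q : V →ₗ[ℝ] V →ₗ[ℝ] ℝ)
    (hQ : ∀ f g : V, Q f g = Q g f)
    (ω : A →ₗ[ℂ] ℂ)
    (hω : ∀ f : V, ω (W f) = Complex.exp (-(Q f f : ℂ) / 2)) :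
    ∀ f g : V,
      ω (C f * C g * C f + S f * C g * S f)
        = ((Real.cos (E f g) : ℝ) : ℂ) * Complex.exp (-(Q g g : ℂ) / 2) ∧
      ω (C f * C ((2 : ℝ) • g) * C f + S f * C ((2 : ℝ) • g) * S f)
        = ((Real.cos (2 * E f g) : ℝ) : ℂ) * Complex.exp (-2 * (Q g g : ℂ)) := by
  have conj : ∀ f g : V, W f * W g * W (-f) = Complex.exp (-(E f g : ℂ) * Complex.I) • W g := by
    intro f g
    have h0 : E f f = 0 := by linarith [hE f f]
    have h1 : E (f + g) (-f) = E f g := by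
      simp only [map_add, map_neg, LinearMap.add_apply, h0]
      linarith [hE f g]
    have h2 : f + g + -f = g := by abel
    rw [hW, smul_mul_assoc, hW, h1, h2, smul_smul, ← Complex.exp_add]
    congr 2
    ring
  have sand : ∀ f x : _, C f * x * C f + S f * x * S f
      = (2 : ℂ)⁻¹ • (W f * x * W (-f) + W (-f) * x * W f) := by
    intro f x
    have hI : (2 * Complex.I)⁻¹ * (2 * Complex.I)⁻¹ = -(4 : ℂ)⁻¹ := by
      rw [← mul_inv, show 2 * Complex.I * (2 * Complex.I) = 4 * (Complex.I * Complex.I) by ring,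
        Complex.I_mul_I]
      norm_num
    rw [hC, hS]
    simp only [smul_mul_assoc, mul_smul_comm, smul_smul, hI]
    simp only [add_mul, mul_add, sub_mul, mul_sub]
    module
  have main : ∀ f g : V, ω (C f * C g * C f + S f * C g * S f)
        = ((Real.cos (E f g) : ℝ) : ℂ) * Complex.exp (-(Q g g : ℂ) / 2) := by
    intro f g
    have c1 := conj f g
    have c2 := conj f (-g)
    have c3 := conj (-f) g
    have c4 := conj (-f) (-g)
    simp only [neg_neg, map_neg, LinearMap.neg_apply, Complex.ofReal_neg] at c1 c2 c3 c4
    rw [sand, hC g]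
    simp only [mul_smul_comm, smul_mul_assoc, mul_add, add_mul, c1, c2, c3, c4]
    simp only [map_add, map_smul, hω, map_neg, LinearMap.neg_apply, neg_neg, smul_eq_mul,
      Complex.ofReal_cos, Complex.cos]
    ring
  intro f g
  refine ⟨main f g, ?_⟩
  rw [main]
  simp only [map_smul, LinearMap.smul_apply, smul_eq_mul]
  congr 2
  push_cast
  ring
end
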